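/- Drucker–Prager return to the apex: in the apex-return case (Ψ(σ^tr) > 0 and η p^tr − (Kη²/(G√2)) ρ^tr ≥ c), the updates σ_k = (c/η) I and ε^p_k = ε_k − (c/(3Kη)) I satisfy the state equation σ_k = ℂ(ε_k − ε^p_k), the consistency condition Ψ(σ_k) = 0, and the maximum-dissipation variational inequality (ε^p_k − ε^p_{k−1}) : (τ − σ_k) ≤ 0 for every τ ∈ Sym(3) with Ψ(τ) ≤ 0. -/

import Mathlib

open Matrix

/-- Frobenius inner product on 3×3 real matrices. -/
noncomputable def frob (σ τ : Matrix (Fin 3) (Fin 3) ℝ) : ℝ := ∑ i, ∑ j, σ i j * τ i j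

/-- Frobenius norm. -/
noncomputable def fnorm (τ : Matrix (Fin 3) (Fin 3) ℝ) : ℝ := Real.sqrt (frob τ τ)

/-- Deviatoric part. -/
noncomputable def devM (τ : Matrix (Fin 3) (Fin 3) ℝ) : Matrix (Fin 3) (Fin 3) ℝ :=
  τ - (Matrix.trace τ / 3) • (1 : Matrix (Fin 3) (Fin 3) ℝ)

/-- The isotropic elasticity tensor `ℂε = K tr(ε) I + 2G dev(ε)`. -/
noncomputable def Celast (K G : ℝ) (ε : Matrix (Fin 3) (Fin 3) ℝ) : Matrix (Fin 3) (Fin 3) ℝ :=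
  (K * Matrix.trace ε) • (1 : Matrix (Fin 3) (Fin 3) ℝ) + (2 * G) • devM ε

/-- The Drucker–Prager yield function `Ψ(τ) = √(1/2)|dev τ| + (η/3) tr τ − c`. -/
noncomputable def PsiDP (η c : ℝ) (τ : Matrix (Fin 3) (Fin 3) ℝ) : ℝ :=
  Real.sqrt (1 / 2) * fnorm (devM τ) + η / 3 * Matrix.trace τ - c

/-- Cauchy–Schwarz inequality for the Frobenius inner product. -/
theorem frob_le_fnorm_mul_fnorm (σ τ : Matrix (Fin 3) (Fin 3) ℝ) :
    frob σ τ ≤ fnorm σ * fnorm τ := by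
  have h := Real.sum_mul_le_sqrt_mul_sqrt (Finset.univ : Finset (Fin 3 × Fin 3))
    (fun p => σ p.1 p.2) (fun p => τ p.1 p.2)
  simpa only [Fintype.sum_prod_type, frob, fnorm, sq] using h

theorem fnorm_nonneg (τ : Matrix (Fin 3) (Fin 3) ℝ) : 0 ≤ fnorm τ :=
  Real.sqrt_nonneg _

theorem fnorm_smul_of_nonneg {a : ℝ} (ha : 0 ≤ a) (τ : Matrix (Fin 3) (Fin 3) ℝ) :
    fnorm (a • τ) = a * fnorm τ := by
  have h : frob (a • τ) (a • τ) = a ^ 2 * frob τ τ := by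
    simp only [frob, Matrix.smul_apply, smul_eq_mul, Finset.mul_sum]
    exact Finset.sum_congr rfl fun i _ => Finset.sum_congr rfl fun j _ => by ring
  rw [fnorm, fnorm, h, Real.sqrt_mul (sq_nonneg a), Real.sqrt_sq ha]

/-- The deviatoric and spherical parts are orthogonal for the Frobenius inner product. -/
theorem frob_eq_frob_devM_add (σ τ : Matrix (Fin 3) (Fin 3) ℝ) :
    frob σ τ = frob (devM σ) (devM τ) + Matrix.trace σ * Matrix.trace τ / 3 := by
  simp [frob, devM, Fin.sum_univ_three, Matrix.trace_fin_three]
  ring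

theorem trace_sub_smul_one (τ : Matrix (Fin 3) (Fin 3) ℝ) (a : ℝ) :
    Matrix.trace (τ - a • (1 : Matrix (Fin 3) (Fin 3) ℝ)) = Matrix.trace τ - 3 * a := by
  simp [mul_comm]

theorem devM_sub_smul_one (τ : Matrix (Fin 3) (Fin 3) ℝ) (a : ℝ) :
    devM (τ - a • (1 : Matrix (Fin 3) (Fin 3) ℝ)) = devM τ := by
  rw [devM, devM, trace_sub_smul_one]
  module

theorem trace_smul_one_fin_three (a : ℝ) :
    Matrix.trace (a • (1 : Matrix (Fin 3) (Fin 3) ℝ)) = 3 * a := by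
  simp [mul_comm]

theorem devM_smul_one (a : ℝ) : devM (a • (1 : Matrix (Fin 3) (Fin 3) ℝ)) = 0 := by
  rw [devM, trace_smul_one_fin_three]
  module

theorem trace_devM (τ : Matrix (Fin 3) (Fin 3) ℝ) : Matrix.trace (devM τ) = 0 := by
  rw [devM, trace_sub_smul_one]
  ring

theorem trace_Celast (K G : ℝ) (ε : Matrix (Fin 3) (Fin 3) ℝ) :
    Matrix.trace (Celast K G ε) = 3 * (K * Matrix.trace ε) := by
  rw [Celast, Matrix.trace_add, trace_smul_one_fin_three, Matrix.trace_smul, trace_devM]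
  simp

theorem devM_Celast (K G : ℝ) (ε : Matrix (Fin 3) (Fin 3) ℝ) :
    devM (Celast K G ε) = (2 * G) • devM ε := by
  rw [devM, trace_Celast, Celast]
  module

/-- Drucker–Prager return to the apex: in the apex-return case the updates
`σₖ = (c/η) I` and `εₖᵖ = εₖ − (c/(3Kη)) I` satisfy the state equation
`σₖ = ℂ(εₖ − εₖᵖ)`, the consistency condition `Ψ(σₖ) = 0`, and the
maximum-dissipation variational inequality. -/
theorem druckerPrager_apex_return (K G η c : ℝ)
    (hK : 0 < K) (hG : 0 < G) (hη : 0 < η) (hc : 0 < c)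
    (εk εp : Matrix (Fin 3) (Fin 3) ℝ) (hεk : εk.IsSymm) (hεp : εp.IsSymm)
    (σtr str σk εpk : Matrix (Fin 3) (Fin 3) ℝ) (ρtr ptr : ℝ)
    (hσtr : σtr = Celast K G (εk - εp))
    (hstr : str = devM σtr) (hρtr : ρtr = fnorm str)
    (hptr : ptr = Matrix.trace σtr / 3)
    (hcase1 : 0 < PsiDP η c σtr)
    (hcase2 : c ≤ η * ptr - K * η ^ 2 / (G * Real.sqrt 2) * ρtr)
    (hσk : σk = (c / η) • (1 : Matrix (Fin 3) (Fin 3) ℝ))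
    (hεpk : εpk = εk - (c / (3 * K * η)) • (1 : Matrix (Fin 3) (Fin 3) ℝ)) :
    σk = Celast K G (εk - εpk) ∧ PsiDP η c σk = 0 ∧
    ∀ τ : Matrix (Fin 3) (Fin 3) ℝ, τ.IsSymm → PsiDP η c τ ≤ 0 →
      frob (εpk - εp) (τ - σk) ≤ 0 := by
  subst hσtr hstr hρtr hptr hσk hεpk
  refine ⟨?_, ?_, ?_⟩
  · rw [sub_sub_cancel, Celast, devM_smul_one, trace_smul_one_fin_three, smul_zero, add_zero]
    congr 1
    field_simp
  · have h0 : fnorm (0 : Matrix (Fin 3) (Fin 3) ℝ) = 0 := by simp [fnorm, frob]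
    rw [PsiDP, devM_smul_one, trace_smul_one_fin_three, h0]
    field_simp
    ring
  · intro τ _ hτ
    rw [sub_right_comm, frob_eq_frob_devM_add, devM_sub_smul_one, devM_sub_smul_one,
      trace_sub_smul_one, trace_sub_smul_one]
    rw [devM_Celast, fnorm_smul_of_nonneg (by positivity), trace_Celast] at hcase2
    rw [PsiDP, Real.sqrt_div zero_le_one, Real.sqrt_one] at hτ
    have hCS := frob_le_fnorm_mul_fnorm (devM (εk - εp)) (devM τ)
    have hx := fnorm_nonneg (devM (εk - εp))
    have hy := fnorm_nonneg (devM τ)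
    generalize frob (devM (εk - εp)) (devM τ) = f at *
    generalize fnorm (devM (εk - εp)) = x at *
    generalize fnorm (devM τ) = y at *
    generalize Matrix.trace (εk - εp) = t at *
    generalize Matrix.trace τ = q at *
    have hs : (0 : ℝ) < √2 := by positivity
    have hs2 : √2 * √2 = (2 : ℝ) := Real.mul_self_sqrt zero_le_two
    generalize √(2 : ℝ) = s at *
    have hplastic : s * η * x ≤ t - 3 * (c / (3 * K * η)) := by
      have e : K * η ^ 2 / (G * s) * (2 * G * x) = K * η * (s * η * x) := by
        field_simp
        linear_combination -x * hs2
      have e' : η * (3 * (K * t) / 3) - c = K * η * (t - 3 * (c / (3 * K * η))) := by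
        field_simp
      exact le_of_mul_le_mul_left (by linarith) (mul_pos hK hη)
    have hstress : y / (s * η) ≤ -(q - 3 * (c / η)) / 3 := by
      have e : 1 / s * y = η * (y / (s * η)) := by field_simp
      have e' : η / 3 * q - c = -(η * (-(q - 3 * (c / η)) / 3)) := by
        field_simp
      exact le_of_mul_le_mul_left (by linarith) hη
    have hprod := mul_le_mul hplastic hstress (by positivity) (le_trans (by positivity) hplastic)
    have e : s * η * x * (y / (s * η)) = x * y := by field_simp
    linarith
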